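/- (i) If an orean form F over a category C has a semiexact decomposition (κ_s, κ_e), then F_s is isomorphic to F_c and F_e is isomorphic to F_n (in particular F is strongly orean); moreover, F satisfies (N2) if and only if (F_s, F_e) is an orean factorization of C. (ii) For any orean factorization (F_s, F_e) of C, the product form F' = F_s × F_e satisfies (N2) and has a semiexact join decomposition F' = F'_s ∨ F'_e with F'_s isomorphic to F_s and F'_e isomorphic to F_e. -/

import Mathlib

open CategoryTheory

universe w v u

/-- A form over a category `C`, presented as a cluster system:
clusters per object and relations `B ≥_f A` (written `Rel f A B`),
satisfying (F1)-(F3). -/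
structure Form (C : Type u) [Category.{v} C] where
  Cl : C → Type w
  Rel : ∀ {X Y : C}, (X ⟶ Y) → Cl X → Cl Y → Prop
  rel_id : ∀ {X : C} (A : Cl X), Rel (𝟙 X) A A
  rel_comp : ∀ {X Y Z : C} {f : X ⟶ Y} {g : Y ⟶ Z} {A : Cl X} {B : Cl Y} {D : Cl Z},
      Rel f A B → Rel g B D → Rel (f ≫ g) A D
  rel_antisymm : ∀ {X : C} {A B : Cl X}, Rel (𝟙 X) A B → Rel (𝟙 X) B A → A = B

namespace Form

variable {C : Type u} [Category.{v} C]

/-- The fibre order on clusters. -/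
def le (F : Form C) {X : C} (A B : F.Cl X) : Prop := F.Rel (𝟙 X) A B

/-- `S` is the image of `f`, i.e. the direct image of the top cluster of the
domain of `f` along `f`. -/
def IsImageOf (F : Form C) {W X : C} (S : F.Cl X) (f : W ⟶ X) : Prop :=
  ∃ t : F.Cl W, (∀ A : F.Cl W, F.le A t) ∧ F.Rel f t S ∧ ∀ T : F.Cl X, F.Rel f t T → F.le S T

/-- `S` is the kernel of `g`, i.e. the inverse image of the bottom cluster of the
codomain of `g` along `g`. -/
def IsKernelOf (F : Form C) {X Y : C} (S : F.Cl X) (g : X ⟶ Y) : Prop :=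
  ∃ b : F.Cl Y, (∀ A : F.Cl Y, F.le b A) ∧ F.Rel g S b ∧ ∀ T : F.Cl X, F.Rel g T b → F.le T S

/-- A cluster is conormal when it is an image of some morphism. -/
def ConormalCl (F : Form C) {X : C} (S : F.Cl X) : Prop :=
  ∃ (W : C) (f : W ⟶ X), F.IsImageOf S f

/-- A cluster is normal when it is a kernel of some morphism. -/
def NormalCl (F : Form C) {X : C} (S : F.Cl X) : Prop :=
  ∃ (Y : C) (g : X ⟶ Y), F.IsKernelOf S g

/-- A form is conormal when every cluster is conormal. -/
def IsConormal (F : Form C) : Prop := ∀ (X : C) (S : F.Cl X), F.ConormalCl S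

/-- A form is normal when every cluster is normal. -/
def IsNormal (F : Form C) : Prop := ∀ (X : C) (S : F.Cl X), F.NormalCl S

def IsJoinOf (F : Form C) {X : C} (A B J : F.Cl X) : Prop :=
  F.le A J ∧ F.le B J ∧ ∀ D : F.Cl X, F.le A D → F.le B D → F.le J D

def IsMeetOf (F : Form C) {X : C} (A B M : F.Cl X) : Prop :=
  F.le M A ∧ F.le M B ∧ ∀ D : F.Cl X, F.le D A → F.le D B → F.le D M

/-- `T` is the direct image of `S` along `f`. -/
def IsDimgOf (F : Form C) {X Y : C} (f : X ⟶ Y) (S : F.Cl X) (T : F.Cl Y) : Prop :=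
  F.Rel f S T ∧ ∀ T' : F.Cl Y, F.Rel f S T' → F.le T T'

/-- `S` is the inverse image of `T` along `f`. -/
def IsIimgOf (F : Form C) {X Y : C} (f : X ⟶ Y) (T : F.Cl Y) (S : F.Cl X) : Prop :=
  F.Rel f S T ∧ ∀ S' : F.Cl X, F.Rel f S' T → F.le S' S

/-- Orean form: (O1) fibres are bounded lattices, (O3) direct and inverse images exist,
(O2) relations along composites decompose. -/
def IsOrean (F : Form C) : Prop :=
  (∀ X : C, ∃ b : F.Cl X, ∀ A, F.le b A) ∧
  (∀ X : C, ∃ t : F.Cl X, ∀ A, F.le A t) ∧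
  (∀ (X : C) (A B : F.Cl X), ∃ J, F.IsJoinOf A B J) ∧
  (∀ (X : C) (A B : F.Cl X), ∃ M, F.IsMeetOf A B M) ∧
  (∀ {X Y : C} (f : X ⟶ Y) (S : F.Cl X), ∃ T, F.IsDimgOf f S T) ∧
  (∀ {X Y : C} (f : X ⟶ Y) (T : F.Cl Y), ∃ S, F.IsIimgOf f T S) ∧
  (∀ {X Y Z : C} (f : X ⟶ Y) (g : Y ⟶ Z) (A : F.Cl X) (D : F.Cl Z),
      F.Rel (f ≫ g) A D → ∃ B : F.Cl Y, F.Rel f A B ∧ F.Rel g B D)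

/-- `m` is an embedding of the (conormal) cluster `S`. -/
def IsEmbeddingOf (F : Form C) {W X : C} (m : W ⟶ X) (S : F.Cl X) : Prop :=
  F.IsImageOf S m ∧ ∀ {W' : C} (f' : W' ⟶ X) (S' : F.Cl X),
    F.IsImageOf S' f' → F.le S' S → ∃! g : W' ⟶ W, g ≫ m = f'

/-- `e` is a quotient of the (normal) cluster `K`. -/
def IsQuotientOf (F : Form C) {X Y : C} (e : X ⟶ Y) (K : F.Cl X) : Prop :=
  F.IsKernelOf K e ∧ ∀ {Y' : C} (g' : X ⟶ Y') (K' : F.Cl X),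
    F.IsKernelOf K' g' → F.le K K' → ∃! h : Y ⟶ Y', e ≫ h = g'

/-- The axiom (N1) for a general form, stated via characterizing predicates. -/
def N1 (F : Form C) : Prop :=
  (∀ {X Y : C} (f : X ⟶ Y) (S V : F.Cl X) (T : F.Cl Y) (K J : F.Cl X),
      F.IsDimgOf f S T → F.IsIimgOf f T V → F.IsKernelOf K f → F.IsJoinOf S K J → V = J) ∧
  (∀ {X Y : C} (f : X ⟶ Y) (T : F.Cl Y) (S : F.Cl X) (U I M : F.Cl Y),
      F.IsIimgOf f T S → F.IsDimgOf f S U → F.IsImageOf I f → F.IsMeetOf T I M → U = M)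

/-- The axiom (N2) for a general form. -/
def N2 (F : Form C) : Prop :=
  ∀ {X Y : C} (f : X ⟶ Y), ∃ (I : C) (e : X ⟶ I) (m : I ⟶ Y) (K : F.Cl X) (S : F.Cl Y),
    F.IsKernelOf K f ∧ F.IsQuotientOf e K ∧ F.IsImageOf S f ∧ F.IsEmbeddingOf m S ∧ e ≫ m = f

/-- The axiom (N3) for a general form. -/
def N3 (F : Form C) : Prop :=
  (∀ {X : C} (S T J : F.Cl X), F.NormalCl S → F.NormalCl T → F.IsJoinOf S T J → F.NormalCl J) ∧
  (∀ {X : C} (S T M : F.Cl X), F.ConormalCl S → F.ConormalCl T → F.IsMeetOf S T M → F.ConormalCl M)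

/-- The subform of `F` given by a selection of clusters. -/
def Subform (F : Form C) (P : ∀ X : C, F.Cl X → Prop) : Form C where
  Cl X := {A : F.Cl X // P X A}
  Rel f A B := F.Rel f A.1 B.1
  rel_id A := F.rel_id A.1
  rel_comp h h' := F.rel_comp h h'
  rel_antisymm h h' := Subtype.ext (F.rel_antisymm h h')

/-- The product of two forms over the same category. -/
def prod (F G : Form C) : Form C where
  Cl X := F.Cl X × G.Cl X
  Rel f A B := F.Rel f A.1 B.1 ∧ G.Rel f A.2 B.2
  rel_id A := ⟨F.rel_id A.1, G.rel_id A.2⟩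
  rel_comp h h' := ⟨F.rel_comp h.1 h'.1, G.rel_comp h.2 h'.2⟩
  rel_antisymm h h' := Prod.ext (F.rel_antisymm h.1 h'.1) (G.rel_antisymm h.2 h'.2)

/-- Isomorphism of forms over the same category. -/
def IsIsomorphic (F G : Form C) : Prop :=
  ∃ e : ∀ X : C, F.Cl X ≃ G.Cl X,
    ∀ {X Y : C} (f : X ⟶ Y) (A : F.Cl X) (B : F.Cl Y),
      F.Rel f A B ↔ G.Rel f (e X A) (e Y B)

/-- An orean factorization (stated for general forms): a conormal orean form together
with a normal orean form such that every morphism factors as a quotient of its kernel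
followed by an embedding of its image. -/
def IsOreanFactorization (Fs Fe : Form C) : Prop :=
  Fs.IsOrean ∧ Fs.IsConormal ∧ Fe.IsOrean ∧ Fe.IsNormal ∧
  ∀ {X Y : C} (f : X ⟶ Y), ∃ (I : C) (e : X ⟶ I) (m : I ⟶ Y) (K : Fe.Cl X) (S : Fs.Cl Y),
    Fe.IsKernelOf K f ∧ Fe.IsQuotientOf e K ∧ Fs.IsImageOf S f ∧ Fs.IsEmbeddingOf m S ∧
    e ≫ m = f

end Form

/-- An operator between two forms over the same category. -/
structure Operator {C : Type u} [Category.{v} C] (F G : Form C) where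
  app : ∀ {X : C}, F.Cl X → G.Cl X
  mono : ∀ {X Y : C} {f : X ⟶ Y} {A : F.Cl X} {B : F.Cl Y},
      F.Rel f A B → G.Rel f (app A) (app B)

namespace Operator

variable {C : Type u} [Category.{v} C] {F G : Form C}

/-- A full operator. -/
def Full (τ : Operator F G) : Prop :=
  ∀ {X Y : C} {f : X ⟶ Y} {A : F.Cl X} {B : F.Cl Y},
    G.Rel f (τ.app A) (τ.app B) → F.Rel f A B

/-- A conormal operator: it maps images of morphisms to images. -/
def Conormal (τ : Operator F G) : Prop :=
  ∀ {W X : C} (f : W ⟶ X) (S : F.Cl X), F.IsImageOf S f → G.IsImageOf (τ.app S) f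

/-- A normal operator: it maps kernels of morphisms to kernels. -/
def Normal (τ : Operator F G) : Prop :=
  ∀ {X Y : C} (g : X ⟶ Y) (S : F.Cl X), F.IsKernelOf S g → G.IsKernelOf (τ.app S) g

end Operator

/-- The identity operator. -/
def Form.idOp {C : Type u} [Category.{v} C] (F : Form C) : Operator F F :=
  ⟨fun A => A, fun h => h⟩

/-- The inclusion of a subform. -/
def Form.subformIncl {C : Type u} [Category.{v} C] (F : Form C) (P : ∀ X : C, F.Cl X → Prop) :
    Operator (F.Subform P) F where
  app A := A.1
  mono h := h

/-- The subform of clusters fixed by an operator `κ : F → F`. -/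
def Form.fixedSubform {C : Type u} [Category.{v} C] (F : Form C) (κ : Operator F F) : Form C :=
  F.Subform (fun _ A => κ.app A = A)

/-- A semiexact pair of forms. -/
def IsSemiexactPair {C : Type u} [Category.{v} C] (Fs Fe : Form C) : Prop :=
  Fs.IsOrean ∧ Fs.IsConormal ∧ Fe.IsOrean ∧ Fe.IsNormal ∧
  (∃ α : Operator Fs Fe, α.Conormal) ∧ (∃ β : Operator Fe Fs, β.Normal)

/-- A left exact pair of forms: a semiexact pair where the conormal operator is a
left inverse of the normal operator. -/
def IsLeftExactPair {C : Type u} [Category.{v} C] (Fs Fe : Form C) : Prop :=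
  Fs.IsOrean ∧ Fs.IsConormal ∧ Fe.IsOrean ∧ Fe.IsNormal ∧
  ∃ (α : Operator Fs Fe) (β : Operator Fe Fs), α.Conormal ∧ β.Normal ∧
    ∀ {X : C} (R : Fe.Cl X), α.app (β.app R) = R

/-- An orean form, with the (uniquely determined) bounded-lattice and
direct/inverse image structure bundled. -/
structure OreanForm (C : Type u) [Category.{v} C] extends Form C where
  bot : ∀ X : C, Cl X
  top : ∀ X : C, Cl X
  join : ∀ {X : C}, Cl X → Cl X → Cl X
  meet : ∀ {X : C}, Cl X → Cl X → Cl X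
  dimg : ∀ {X Y : C}, (X ⟶ Y) → Cl X → Cl Y
  iimg : ∀ {X Y : C}, (X ⟶ Y) → Cl Y → Cl X
  bot_le : ∀ {X : C} (A : Cl X), Rel (𝟙 X) (bot X) A
  le_top : ∀ {X : C} (A : Cl X), Rel (𝟙 X) A (top X)
  le_join_left : ∀ {X : C} (A B : Cl X), Rel (𝟙 X) A (join A B)
  le_join_right : ∀ {X : C} (A B : Cl X), Rel (𝟙 X) B (join A B)
  join_le : ∀ {X : C} {A B D : Cl X}, Rel (𝟙 X) A D → Rel (𝟙 X) B D → Rel (𝟙 X) (join A B) D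
  meet_le_left : ∀ {X : C} (A B : Cl X), Rel (𝟙 X) (meet A B) A
  meet_le_right : ∀ {X : C} (A B : Cl X), Rel (𝟙 X) (meet A B) B
  le_meet : ∀ {X : C} {A B D : Cl X}, Rel (𝟙 X) D A → Rel (𝟙 X) D B → Rel (𝟙 X) D (meet A B)
  rel_dimg : ∀ {X Y : C} (f : X ⟶ Y) (S : Cl X), Rel f S (dimg f S)
  dimg_le : ∀ {X Y : C} {f : X ⟶ Y} {S : Cl X} {T : Cl Y}, Rel f S T → Rel (𝟙 Y) (dimg f S) T
  iimg_rel : ∀ {X Y : C} (f : X ⟶ Y) (T : Cl Y), Rel f (iimg f T) T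
  le_iimg : ∀ {X Y : C} {f : X ⟶ Y} {S : Cl X} {T : Cl Y}, Rel f S T → Rel (𝟙 X) S (iimg f T)
  rel_decomp : ∀ {X Y Z : C} {f : X ⟶ Y} {g : Y ⟶ Z} {A : Cl X} {D : Cl Z},
      Rel (f ≫ g) A D → ∃ B : Cl Y, Rel f A B ∧ Rel g B D

namespace OreanForm

variable {C : Type u} [Category.{v} C]

def le (F : OreanForm C) {X : C} (A B : F.Cl X) : Prop := F.Rel (𝟙 X) A B

/-- The image of a morphism: direct image of the top cluster. -/
def Im (F : OreanForm C) {W X : C} (f : W ⟶ X) : F.Cl X := F.dimg f (F.top W)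

/-- The kernel of a morphism: inverse image of the bottom cluster. -/
def Ker (F : OreanForm C) {X Y : C} (g : X ⟶ Y) : F.Cl X := F.iimg g (F.bot Y)

def Conormal (F : OreanForm C) {X : C} (S : F.Cl X) : Prop :=
  ∃ (W : C) (f : W ⟶ X), F.Im f = S

def Normal (F : OreanForm C) {X : C} (S : F.Cl X) : Prop :=
  ∃ (Y : C) (g : X ⟶ Y), F.Ker g = S

def IsConormalForm (F : OreanForm C) : Prop := ∀ {X : C} (S : F.Cl X), F.Conormal S

def IsNormalForm (F : OreanForm C) : Prop := ∀ {X : C} (S : F.Cl X), F.Normal S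

def IsBinormalForm (F : OreanForm C) : Prop := F.IsConormalForm ∧ F.IsNormalForm

/-- `m` is an embedding of the cluster `S`. -/
def IsEmbedding (F : OreanForm C) {W X : C} (m : W ⟶ X) (S : F.Cl X) : Prop :=
  F.Im m = S ∧ ∀ {W' : C} (f' : W' ⟶ X), F.le (F.Im f') S → ∃! g : W' ⟶ W, g ≫ m = f'

/-- `e` is a quotient of the cluster `K`. -/
def IsQuotient (F : OreanForm C) {X Y : C} (e : X ⟶ Y) (K : F.Cl X) : Prop :=
  F.Ker e = K ∧ ∀ {Y' : C} (g' : X ⟶ Y'), F.le K (F.Ker g') → ∃! h : Y ⟶ Y', e ≫ h = g'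

/-- The axiom (N1) at a given morphism. -/
def N1At (F : OreanForm C) {X Y : C} (f : X ⟶ Y) : Prop :=
  (∀ S : F.Cl X, F.iimg f (F.dimg f S) = F.join S (F.Ker f)) ∧
  (∀ T : F.Cl Y, F.dimg f (F.iimg f T) = F.meet T (F.Im f))

def N1 (F : OreanForm C) : Prop := ∀ {X Y : C} (f : X ⟶ Y), F.N1At f

def N2 (F : OreanForm C) : Prop :=
  ∀ {X Y : C} (f : X ⟶ Y), ∃ (I : C) (e : X ⟶ I) (m : I ⟶ Y),
    F.IsQuotient e (F.Ker f) ∧ F.IsEmbedding m (F.Im f) ∧ e ≫ m = f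

def N3 (F : OreanForm C) : Prop :=
  (∀ {X : C} (S T : F.Cl X), F.Normal S → F.Normal T → F.Normal (F.join S T)) ∧
  (∀ {X : C} (S T : F.Cl X), F.Conormal S → F.Conormal T → F.Conormal (F.meet S T))

def IsNoetherian (F : OreanForm C) : Prop := F.N1 ∧ F.N2 ∧ F.N3

/-- The conormal hull: the subform of conormal clusters. -/
def conormalHull (F : OreanForm C) : Form C := F.toForm.Subform (fun _ S => F.Conormal S)

/-- The normal hull: the subform of normal clusters. -/
def normalHull (F : OreanForm C) : Form C := F.toForm.Subform (fun _ S => F.Normal S)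

def conormalIncl (F : OreanForm C) : Operator F.conormalHull F.toForm :=
  F.toForm.subformIncl _

def normalIncl (F : OreanForm C) : Operator F.normalHull F.toForm :=
  F.toForm.subformIncl _

/-- A strongly orean form: the conormal and normal hulls are both orean. -/
def StronglyOrean (F : OreanForm C) : Prop :=
  F.conormalHull.IsOrean ∧ F.normalHull.IsOrean

/-- `T` is the conormal interior of `S` (largest conormal cluster below `S`). -/
def IsConormalInterior (F : OreanForm C) {X : C} (S T : F.Cl X) : Prop :=
  F.Conormal T ∧ F.le T S ∧ ∀ T' : F.Cl X, F.Conormal T' → F.le T' S → F.le T' T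

/-- `T` is the conormal exterior of `S` (smallest conormal cluster above `S`). -/
def IsConormalExterior (F : OreanForm C) {X : C} (S T : F.Cl X) : Prop :=
  F.Conormal T ∧ F.le S T ∧ ∀ T' : F.Cl X, F.Conormal T' → F.le S T' → F.le T T'

/-- `T` is the normal interior of `S` (largest normal cluster below `S`). -/
def IsNormalInterior (F : OreanForm C) {X : C} (S T : F.Cl X) : Prop :=
  F.Normal T ∧ F.le T S ∧ ∀ T' : F.Cl X, F.Normal T' → F.le T' S → F.le T' T

/-- `T` is the normal exterior of `S` (smallest normal cluster above `S`). -/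
def IsNormalExterior (F : OreanForm C) {X : C} (S T : F.Cl X) : Prop :=
  F.Normal T ∧ F.le S T ∧ ∀ T' : F.Cl X, F.Normal T' → F.le S T' → F.le T T'

/-- Componentwise product of orean forms. -/
def prod (F G : OreanForm C) : OreanForm C where
  toForm := F.toForm.prod G.toForm
  bot X := (F.bot X, G.bot X)
  top X := (F.top X, G.top X)
  join A B := (F.join A.1 B.1, G.join A.2 B.2)
  meet A B := (F.meet A.1 B.1, G.meet A.2 B.2)
  dimg f S := (F.dimg f S.1, G.dimg f S.2)
  iimg f T := (F.iimg f T.1, G.iimg f T.2)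
  bot_le A := ⟨F.bot_le A.1, G.bot_le A.2⟩
  le_top A := ⟨F.le_top A.1, G.le_top A.2⟩
  le_join_left A B := ⟨F.le_join_left A.1 B.1, G.le_join_left A.2 B.2⟩
  le_join_right A B := ⟨F.le_join_right A.1 B.1, G.le_join_right A.2 B.2⟩
  join_le h h' := ⟨F.join_le h.1 h'.1, G.join_le h.2 h'.2⟩
  meet_le_left A B := ⟨F.meet_le_left A.1 B.1, G.meet_le_left A.2 B.2⟩
  meet_le_right A B := ⟨F.meet_le_right A.1 B.1, G.meet_le_right A.2 B.2⟩
  le_meet h h' := ⟨F.le_meet h.1 h'.1, G.le_meet h.2 h'.2⟩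
  rel_dimg f S := ⟨F.rel_dimg f S.1, G.rel_dimg f S.2⟩
  dimg_le h := ⟨F.dimg_le h.1, G.dimg_le h.2⟩
  iimg_rel f T := ⟨F.iimg_rel f T.1, G.iimg_rel f T.2⟩
  le_iimg h := ⟨F.le_iimg h.1, G.le_iimg h.2⟩
  rel_decomp h := by
    obtain ⟨B1, h1, h1'⟩ := F.rel_decomp h.1
    obtain ⟨B2, h2, h2'⟩ := G.rel_decomp h.2
    exact ⟨(B1, B2), ⟨h1, h2⟩, ⟨h1', h2'⟩⟩

end OreanForm

/-- An orean factorization, stated for orean forms. -/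
def OreanFactorization {C : Type u} [Category.{v} C] (Fs Fe : OreanForm C) : Prop :=
  Fs.IsConormalForm ∧ Fe.IsNormalForm ∧
  ∀ {X Y : C} (f : X ⟶ Y), ∃ (I : C) (e : X ⟶ I) (m : I ⟶ Y),
    Fe.IsQuotient e (Fe.Ker f) ∧ Fs.IsEmbedding m (Fs.Im f) ∧ e ≫ m = f

/-- A conormal operator between orean forms (preserves images). -/
def OpConormal {C : Type u} [Category.{v} C] {Fs Fe : OreanForm C}
    (α : Operator Fs.toForm Fe.toForm) : Prop :=
  ∀ {W X : C} (f : W ⟶ X), α.app (Fs.Im f) = Fe.Im f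

/-- A normal operator between orean forms (preserves kernels). -/
def OpNormal {C : Type u} [Category.{v} C] {Fs Fe : OreanForm C}
    (β : Operator Fs.toForm Fe.toForm) : Prop :=
  ∀ {X Y : C} (g : X ⟶ Y), β.app (Fs.Ker g) = Fe.Ker g

/-- `W` is the Wyler join `A ∗ R = (π_R ·ˢ A) ·ˢ π_R` relative to an orean
factorization `(Fs, Fe)`. -/
def WylerJoin {C : Type u} [Category.{v} C] (Fs Fe : OreanForm C) {X : C}
    (A : Fs.Cl X) (R : Fe.Cl X) (W : Fs.Cl X) : Prop :=
  ∃ (Q : C) (p : X ⟶ Q), Fe.IsQuotient p R ∧ Fs.iimg p (Fs.dimg p A) = W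

section Decomp

variable {C : Type u} [Category.{v} C]

/-- Core of a decomposition: a pair of idempotent operators whose subforms of fixed
clusters are a conormal orean form resp. a normal orean form. -/
def IsDecompCore (F : OreanForm C) (κs κe : Operator F.toForm F.toForm) : Prop :=
  (∀ {X : C} (A : F.Cl X), κs.app (κs.app A) = κs.app A) ∧
  (∀ {X : C} (A : F.Cl X), κe.app (κe.app A) = κe.app A) ∧
  (F.toForm.fixedSubform κs).IsOrean ∧ (F.toForm.fixedSubform κs).IsConormal ∧
  (F.toForm.fixedSubform κe).IsOrean ∧ (F.toForm.fixedSubform κe).IsNormal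

def JoinEq (F : OreanForm C) (κs κe : Operator F.toForm F.toForm) : Prop :=
  ∀ {X : C} (S : F.Cl X), S = F.join (κs.app S) (κe.app S)

def MeetEq (F : OreanForm C) (κs κe : Operator F.toForm F.toForm) : Prop :=
  ∀ {X : C} (S : F.Cl X), S = F.meet (κs.app S) (κe.app S)

def LeftEq (F : OreanForm C) (κs : Operator F.toForm F.toForm) : Prop :=
  ∀ {X : C} (S : F.Cl X), S = κs.app S

def RightEq (F : OreanForm C) (κe : Operator F.toForm F.toForm) : Prop :=
  ∀ {X : C} (S : F.Cl X), S = κe.app S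

def TopEq (F : OreanForm C) : Prop := ∀ {X : C} (S : F.Cl X), S = F.top X

def BotEq (F : OreanForm C) : Prop := ∀ {X : C} (S : F.Cl X), S = F.bot X

/-- A decomposition of an orean form: the decomposing term is one of the six
binary bounded-lattice terms. -/
def IsDecomp (F : OreanForm C) (κs κe : Operator F.toForm F.toForm) : Prop :=
  IsDecompCore F κs κe ∧
  (JoinEq F κs κe ∨ MeetEq F κs κe ∨ LeftEq F κs ∨ RightEq F κe ∨ TopEq F ∨ BotEq F)

def IsJoinDecomp (F : OreanForm C) (κs κe : Operator F.toForm F.toForm) : Prop :=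
  IsDecompCore F κs κe ∧ JoinEq F κs κe

def IsMeetDecomp (F : OreanForm C) (κs κe : Operator F.toForm F.toForm) : Prop :=
  IsDecompCore F κs κe ∧ MeetEq F κs κe

def IsLeftDecomp (F : OreanForm C) (κs κe : Operator F.toForm F.toForm) : Prop :=
  IsDecompCore F κs κe ∧ LeftEq F κs

def IsRightDecomp (F : OreanForm C) (κs κe : Operator F.toForm F.toForm) : Prop :=
  IsDecompCore F κs κe ∧ RightEq F κe

/-- A semiexact decomposition: the decomposition projections are binormal and the pair
of fixed subforms is a semiexact pair. -/
def IsSemiexact (F : OreanForm C) (κs κe : Operator F.toForm F.toForm) : Prop :=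
  (∃ τs : Operator F.toForm (F.toForm.fixedSubform κs),
      (∀ {X : C} (A : F.Cl X), (τs.app A).1 = κs.app A) ∧ τs.Conormal ∧ τs.Normal) ∧
  (∃ τe : Operator F.toForm (F.toForm.fixedSubform κe),
      (∀ {X : C} (A : F.Cl X), (τe.app A).1 = κe.app A) ∧ τe.Conormal ∧ τe.Normal) ∧
  IsSemiexactPair (F.toForm.fixedSubform κs) (F.toForm.fixedSubform κe)

/-- An exact decomposition: semiexact, and the subform inclusions are
conormal resp. normal. -/
def IsExact (F : OreanForm C) (κs κe : Operator F.toForm F.toForm) : Prop :=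
  IsSemiexact F κs κe ∧
  (F.toForm.subformIncl (fun _ A => κs.app A = A)).Conormal ∧
  (F.toForm.subformIncl (fun _ A => κe.app A = A)).Normal

end Decomp

section Helpers

variable {C : Type u} [Category.{v} C]

theorem Form.le_rel (F : Form C) {X Y : C} {f : X ⟶ Y} {A B : F.Cl X} {D : F.Cl Y}
    (h : F.Rel (𝟙 X) A B) (h' : F.Rel f B D) : F.Rel f A D := by
  simpa using F.rel_comp h h'

theorem Form.rel_le (F : Form C) {X Y : C} {f : X ⟶ Y} {A : F.Cl X} {B D : F.Cl Y}
    (h : F.Rel f A B) (h' : F.Rel (𝟙 Y) B D) : F.Rel f A D := by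
  simpa using F.rel_comp h h'

theorem Form.image_unique (F : Form C) {X Y : C} {f : X ⟶ Y} {S T : F.Cl Y}
    (h : F.IsImageOf S f) (h' : F.IsImageOf T f) : S = T := by
  obtain ⟨t, ht, h1, h2⟩ := h
  obtain ⟨t', ht', h1', h2'⟩ := h'
  have : t = t' := F.rel_antisymm (ht' t) (ht t')
  subst this
  exact F.rel_antisymm (h2 _ h1') (h2' _ h1)

theorem Form.kernel_unique (F : Form C) {X Y : C} {f : X ⟶ Y} {S T : F.Cl X}
    (h : F.IsKernelOf S f) (h' : F.IsKernelOf T f) : S = T := by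
  obtain ⟨t, ht, h1, h2⟩ := h
  obtain ⟨t', ht', h1', h2'⟩ := h'
  have : t = t' := F.rel_antisymm (ht t') (ht' t)
  subst this
  exact F.rel_antisymm (h2' _ h1) (h2 _ h1')

theorem Form.IsOrean.exists_image {F : Form C} (h : F.IsOrean) {X Y : C} (f : X ⟶ Y) :
    ∃ S, F.IsImageOf S f := by
  obtain ⟨t, ht⟩ := h.2.1 X
  obtain ⟨S, h1, h2⟩ := h.2.2.2.2.1 f t
  exact ⟨S, t, ht, h1, h2⟩

theorem Form.IsOrean.exists_kernel {F : Form C} (h : F.IsOrean) {X Y : C} (f : X ⟶ Y) :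
    ∃ S, F.IsKernelOf S f := by
  obtain ⟨t, ht⟩ := h.1 Y
  obtain ⟨S, h1, h2⟩ := h.2.2.2.2.2.1 f t
  exact ⟨S, t, ht, h1, h2⟩

namespace OreanForm

theorem isImageOf_Im (F : OreanForm C) {X Y : C} (f : X ⟶ Y) : F.toForm.IsImageOf (F.Im f) f :=
  ⟨F.top X, fun A => F.le_top A, F.rel_dimg _ _, fun _ h => F.dimg_le h⟩

theorem isKernelOf_Ker (F : OreanForm C) {X Y : C} (f : X ⟶ Y) :
    F.toForm.IsKernelOf (F.Ker f) f :=
  ⟨F.bot Y, fun A => F.bot_le A, F.iimg_rel _ _, fun _ h => F.le_iimg h⟩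

theorem isImageOf_iff (F : OreanForm C) {X Y : C} (f : X ⟶ Y) (S : F.Cl Y) :
    F.toForm.IsImageOf S f ↔ F.Im f = S :=
  ⟨fun h => F.toForm.image_unique (F.isImageOf_Im f) h, fun h => h ▸ F.isImageOf_Im f⟩

theorem isKernelOf_iff (F : OreanForm C) {X Y : C} (f : X ⟶ Y) (S : F.Cl X) :
    F.toForm.IsKernelOf S f ↔ F.Ker f = S :=
  ⟨fun h => F.toForm.kernel_unique (F.isKernelOf_Ker f) h, fun h => h ▸ F.isKernelOf_Ker f⟩

theorem isOrean (F : OreanForm C) : F.toForm.IsOrean :=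
  ⟨fun X => ⟨F.bot X, fun A => F.bot_le A⟩, fun X => ⟨F.top X, fun A => F.le_top A⟩,
   fun _ A B => ⟨F.join A B, F.le_join_left A B, F.le_join_right A B, fun _ h h' => F.join_le h h'⟩,
   fun _ A B => ⟨F.meet A B, F.meet_le_left A B, F.meet_le_right A B, fun _ h h' => F.le_meet h h'⟩,
   fun f S => ⟨F.dimg f S, F.rel_dimg f S, fun _ h => F.dimg_le h⟩,
   fun f S => ⟨F.iimg f S, F.iimg_rel f S, fun _ h => F.le_iimg h⟩,
   fun _ _ _ _ h => F.rel_decomp h⟩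

theorem rel_of_le_iimg (F : OreanForm C) {X Y : C} {f : X ⟶ Y} {S : F.Cl X} {T : F.Cl Y}
    (h : F.Rel (𝟙 X) S (F.iimg f T)) : F.Rel f S T := F.toForm.le_rel h (F.iimg_rel f T)

theorem rel_of_dimg_le (F : OreanForm C) {X Y : C} {f : X ⟶ Y} {S : F.Cl X} {T : F.Cl Y}
    (h : F.Rel (𝟙 Y) (F.dimg f S) T) : F.Rel f S T := F.toForm.rel_le (F.rel_dimg f S) h

theorem dimg_comp (F : OreanForm C) {X Y Z : C} (f : X ⟶ Y) (g : Y ⟶ Z) (S : F.Cl X) :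
    F.dimg (f ≫ g) S = F.dimg g (F.dimg f S) := by
  apply F.rel_antisymm
  · exact F.dimg_le (F.rel_comp (F.rel_dimg f S) (F.rel_dimg g _))
  · obtain ⟨B, h1, h2⟩ := F.rel_decomp (F.rel_dimg (f ≫ g) S)
    exact F.dimg_le (F.toForm.le_rel (F.dimg_le h1) h2)

theorem iimg_comp (F : OreanForm C) {X Y Z : C} (f : X ⟶ Y) (g : Y ⟶ Z) (S : F.Cl Z) :
    F.iimg (f ≫ g) S = F.iimg f (F.iimg g S) := by
  apply F.rel_antisymm
  · obtain ⟨B, h1, h2⟩ := F.rel_decomp (F.iimg_rel (f ≫ g) S)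
    exact F.le_iimg (F.toForm.rel_le h1 (F.le_iimg h2))
  · exact F.le_iimg (F.rel_comp (F.iimg_rel f _) (F.iimg_rel g S))

theorem dimg_mono (F : OreanForm C) {X Y : C} (f : X ⟶ Y) {S T : F.Cl X}
    (h : F.Rel (𝟙 X) S T) : F.Rel (𝟙 Y) (F.dimg f S) (F.dimg f T) :=
  F.dimg_le (F.toForm.le_rel h (F.rel_dimg f T))

theorem iimg_mono (F : OreanForm C) {X Y : C} (f : X ⟶ Y) {S T : F.Cl Y}
    (h : F.Rel (𝟙 Y) S T) : F.Rel (𝟙 X) (F.iimg f S) (F.iimg f T) :=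
  F.le_iimg (F.toForm.rel_le (F.iimg_rel f S) h)

theorem Im_comp (F : OreanForm C) {X Y Z : C} (f : X ⟶ Y) (g : Y ⟶ Z) :
    F.Im (f ≫ g) = F.dimg g (F.Im f) := F.dimg_comp f g _

theorem Ker_comp (F : OreanForm C) {X Y Z : C} (f : X ⟶ Y) (g : Y ⟶ Z) :
    F.Ker (f ≫ g) = F.iimg f (F.Ker g) := F.iimg_comp f g _

theorem Im_comp_le (F : OreanForm C) {X Y Z : C} (f : X ⟶ Y) (g : Y ⟶ Z) :
    F.Rel (𝟙 Z) (F.Im (f ≫ g)) (F.Im g) := by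
  rw [Im_comp]; exact F.dimg_mono g (F.le_top _)

theorem le_Ker_comp (F : OreanForm C) {X Y Z : C} (f : X ⟶ Y) (g : Y ⟶ Z) :
    F.Rel (𝟙 X) (F.Ker f) (F.Ker (f ≫ g)) := by
  rw [Ker_comp]; exact F.iimg_mono f (F.bot_le _)

theorem Im_id (F : OreanForm C) (X : C) : F.Im (𝟙 X) = F.top X :=
  F.rel_antisymm (F.le_top _) (F.rel_dimg (𝟙 X) (F.top X))

theorem Ker_id (F : OreanForm C) (X : C) : F.Ker (𝟙 X) = F.bot X :=
  F.rel_antisymm (F.iimg_rel (𝟙 X) (F.bot X)) (F.bot_le _)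

theorem Im_eq_top_of_section (F : OreanForm C) {X Y : C} (s : Y ⟶ X) (f : X ⟶ Y)
    (h : s ≫ f = 𝟙 Y) : F.Im f = F.top Y :=
  F.rel_antisymm (F.le_top _) (by
    have := F.Im_comp_le s f
    rwa [h, Im_id] at this)

theorem Ker_eq_bot_of_retraction (F : OreanForm C) {X Y : C} (f : X ⟶ Y) (r : Y ⟶ X)
    (h : f ≫ r = 𝟙 X) : F.Ker f = F.bot X :=
  F.rel_antisymm (by
    have := F.le_Ker_comp f r
    rwa [h, Ker_id] at this) (F.bot_le _)

theorem dimg_bot (F : OreanForm C) {X Y : C} (f : X ⟶ Y) : F.dimg f (F.bot X) = F.bot Y :=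
  F.rel_antisymm (F.dimg_le (F.rel_of_le_iimg (F.bot_le _))) (F.bot_le _)

theorem iimg_top (F : OreanForm C) {X Y : C} (f : X ⟶ Y) : F.iimg f (F.top Y) = F.top X :=
  F.rel_antisymm (F.le_top _) (F.le_iimg (F.rel_of_dimg_le (F.le_top _)))

theorem join_bot (F : OreanForm C) {X : C} (A : F.Cl X) : F.join A (F.bot X) = A :=
  F.rel_antisymm (F.join_le (F.rel_id A) (F.bot_le A)) (F.le_join_left _ _)

theorem bot_join (F : OreanForm C) {X : C} (A : F.Cl X) : F.join (F.bot X) A = A :=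
  F.rel_antisymm (F.join_le (F.bot_le A) (F.rel_id A)) (F.le_join_right _ _)

end OreanForm

/-! ### Transfer along isomorphisms -/

theorem Form.isOrean_of_iso {F G : Form C} (h : Form.IsIsomorphic F G) (hF : F.IsOrean) :
    G.IsOrean := by
  obtain ⟨e, he⟩ := h
  have key : ∀ {X Y : C} (f : X ⟶ Y) (A : G.Cl X) (B : G.Cl Y),
      G.Rel f A B ↔ F.Rel f ((e X).symm A) ((e Y).symm B) := by
    intro X Y f A B
    rw [he]; simp
  have key1 : ∀ {X Y : C} (f : X ⟶ Y) (A : F.Cl X) (B : G.Cl Y),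
      G.Rel f (e X A) B ↔ F.Rel f A ((e Y).symm B) := by
    intro X Y f A B
    rw [key]; simp
  have key2 : ∀ {X Y : C} (f : X ⟶ Y) (A : G.Cl X) (B : F.Cl Y),
      G.Rel f A (e Y B) ↔ F.Rel f ((e X).symm A) B := by
    intro X Y f A B
    rw [key]; simp
  obtain ⟨h1, h2, h3, h4, h5, h6, h7⟩ := hF
  refine ⟨fun X => ?_, fun X => ?_, fun X A B => ?_, fun X A B => ?_, ?_, ?_, ?_⟩
  · obtain ⟨b, hb⟩ := h1 X
    exact ⟨e X b, fun A => (key1 _ _ _).2 (hb _)⟩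
  · obtain ⟨b, hb⟩ := h2 X
    exact ⟨e X b, fun A => (key2 _ _ _).2 (hb _)⟩
  · obtain ⟨J, a, b, c⟩ := h3 X ((e X).symm A) ((e X).symm B)
    exact ⟨e X J, (key2 _ _ _).2 a, (key2 _ _ _).2 b, fun D u v =>
      (key1 _ _ _).2 (c _ ((key _ _ _).1 u) ((key _ _ _).1 v))⟩
  · obtain ⟨J, a, b, c⟩ := h4 X ((e X).symm A) ((e X).symm B)
    exact ⟨e X J, (key1 _ _ _).2 a, (key1 _ _ _).2 b, fun D u v =>
      (key2 _ _ _).2 (c _ ((key _ _ _).1 u) ((key _ _ _).1 v))⟩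
  · intro X Y f S
    obtain ⟨T, a, b⟩ := h5 f ((e X).symm S)
    exact ⟨e Y T, (key2 _ _ _).2 a, fun D u => (key1 _ _ _).2 (b _ ((key _ _ _).1 u))⟩
  · intro X Y f S
    obtain ⟨T, a, b⟩ := h6 f ((e Y).symm S)
    exact ⟨e X T, (key1 _ _ _).2 a, fun D u => (key2 _ _ _).2 (b _ ((key _ _ _).1 u))⟩
  · intro X Y Z f g A D h
    obtain ⟨B, a, b⟩ := h7 f g _ _ ((key _ _ _).1 h)
    exact ⟨e Y B, (key2 _ _ _).2 a, (key1 _ _ _).2 b⟩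

theorem Form.IsIsomorphic.symm {F G : Form C} (h : Form.IsIsomorphic F G) :
    Form.IsIsomorphic G F := by
  obtain ⟨e, he⟩ := h
  refine ⟨fun X => (e X).symm, fun {X Y} f A B => ?_⟩
  rw [he]; simp

theorem Form.isImageOf_iso {F G : Form C} (e : ∀ X : C, F.Cl X ≃ G.Cl X)
    (he : ∀ {X Y : C} (f : X ⟶ Y) (A : F.Cl X) (B : F.Cl Y),
      F.Rel f A B ↔ G.Rel f (e X A) (e Y B)) {X Y : C} (f : X ⟶ Y) (S : F.Cl Y) :
    F.IsImageOf S f ↔ G.IsImageOf (e Y S) f := by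
  constructor
  · rintro ⟨t, a, b, c⟩
    refine ⟨e X t, fun A => ?_, (he _ _ _).1 b, fun T h => ?_⟩
    · obtain ⟨A, rfl⟩ := (e X).surjective A
      exact (he _ _ _).1 (a A)
    · obtain ⟨T, rfl⟩ := (e Y).surjective T
      exact (he _ _ _).1 (c T ((he _ _ _).2 h))
  · rintro ⟨t, a, b, c⟩
    obtain ⟨t, rfl⟩ := (e X).surjective t
    exact ⟨t, fun A => (he _ _ _).2 (a _), (he _ _ _).2 b,
      fun T h => (he _ _ _).2 (c _ ((he _ _ _).1 h))⟩

theorem Form.isKernelOf_iso {F G : Form C} (e : ∀ X : C, F.Cl X ≃ G.Cl X)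
    (he : ∀ {X Y : C} (f : X ⟶ Y) (A : F.Cl X) (B : F.Cl Y),
      F.Rel f A B ↔ G.Rel f (e X A) (e Y B)) {X Y : C} (f : X ⟶ Y) (S : F.Cl X) :
    F.IsKernelOf S f ↔ G.IsKernelOf (e X S) f := by
  constructor
  · rintro ⟨t, a, b, c⟩
    refine ⟨e Y t, fun A => ?_, (he _ _ _).1 b, fun T h => ?_⟩
    · obtain ⟨A, rfl⟩ := (e Y).surjective A
      exact (he _ _ _).1 (a A)
    · obtain ⟨T, rfl⟩ := (e X).surjective T
      exact (he _ _ _).1 (c T ((he _ _ _).2 h))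
  · rintro ⟨t, a, b, c⟩
    obtain ⟨t, rfl⟩ := (e Y).surjective t
    exact ⟨t, fun A => (he _ _ _).2 (a _), (he _ _ _).2 b,
      fun T h => (he _ _ _).2 (c _ ((he _ _ _).1 h))⟩

/-! ### Part (i) -/

/-- The decomposing term, as a monotone binary operation. -/
theorem decomp_term (F : OreanForm C) (κs κe : Operator F.toForm F.toForm)
    (h : JoinEq F κs κe ∨ MeetEq F κs κe ∨ LeftEq F κs ∨ RightEq F κe ∨ TopEq F ∨ BotEq F) :
    ∃ t : ∀ X : C, F.Cl X → F.Cl X → F.Cl X,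
      (∀ {X Y : C} {f : X ⟶ Y} {A A' : F.Cl X} {B B' : F.Cl Y},
        F.Rel f A B → F.Rel f A' B' → F.Rel f (t X A A') (t Y B B')) ∧
      ∀ {X : C} (S : F.Cl X), t X (κs.app S) (κe.app S) = S := by
  rcases h with h | h | h | h | h | h
  · refine ⟨fun _ A B => F.join A B, fun a b => ?_, fun S => (h S).symm⟩
    exact F.rel_of_le_iimg (F.join_le
      (F.le_iimg (F.toForm.rel_le a (F.le_join_left _ _)))
      (F.le_iimg (F.toForm.rel_le b (F.le_join_right _ _))))
  · refine ⟨fun _ A B => F.meet A B, fun a b => ?_, fun S => (h S).symm⟩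
    exact F.rel_of_dimg_le (F.le_meet
      (F.dimg_le (F.toForm.le_rel (F.meet_le_left _ _) a))
      (F.dimg_le (F.toForm.le_rel (F.meet_le_right _ _) b)))
  · exact ⟨fun _ A _ => A, fun a _ => a, fun S => (h S).symm⟩
  · exact ⟨fun _ _ B => B, fun _ b => b, fun S => (h S).symm⟩
  · exact ⟨fun X _ _ => F.top X, fun _ _ => F.rel_of_dimg_le (F.le_top _), fun S => (h S).symm⟩
  · exact ⟨fun X _ _ => F.bot X, fun _ _ => F.rel_of_le_iimg (F.bot_le _), fun S => (h S).symm⟩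

theorem conormal_iso (F : OreanForm C) (G : Form C)
    (τ : Operator F.toForm G) (hτ : τ.Conormal) (Φ : Operator G F.toForm) (hΦ : Φ.Conormal)
    (hc : G.IsConormal) : Form.IsIsomorphic G F.conormalHull := by
  have h1 : ∀ {X : C} (A : G.Cl X), τ.app (Φ.app A) = A := by
    intro X A
    obtain ⟨W, f, hf⟩ := hc X A
    exact G.image_unique (hτ f _ (hΦ f _ hf)) hf
  have h2 : ∀ {X : C} (S : F.Cl X), F.Conormal S → Φ.app (τ.app S) = S := by
    rintro X S ⟨W, f, rfl⟩
    exact F.toForm.image_unique (hΦ f _ (hτ f _ (F.isImageOf_Im f))) (F.isImageOf_Im f)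
  refine ⟨fun X => ⟨fun A => ⟨Φ.app A, ?_⟩, fun S => τ.app S.1, fun A => h1 A,
    fun S => Subtype.ext (h2 S.1 S.2)⟩, fun {X Y} f A B => ⟨fun h => Φ.mono h, fun h => ?_⟩⟩
  · obtain ⟨W, f, hf⟩ := hc X A
    exact ⟨W, f, (F.isImageOf_iff _ _).1 (hΦ f _ hf)⟩
  · rw [← h1 A, ← h1 B]
    exact τ.mono h

theorem normal_iso (F : OreanForm C) (G : Form C)
    (τ : Operator F.toForm G) (hτ : τ.Normal) (Φ : Operator G F.toForm) (hΦ : Φ.Normal)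
    (hc : G.IsNormal) : Form.IsIsomorphic G F.normalHull := by
  have h1 : ∀ {X : C} (A : G.Cl X), τ.app (Φ.app A) = A := by
    intro X A
    obtain ⟨W, f, hf⟩ := hc X A
    exact G.kernel_unique (hτ f _ (hΦ f _ hf)) hf
  have h2 : ∀ {X : C} (S : F.Cl X), F.Normal S → Φ.app (τ.app S) = S := by
    rintro X S ⟨W, f, rfl⟩
    exact F.toForm.kernel_unique (hΦ f _ (hτ f _ (F.isKernelOf_Ker f))) (F.isKernelOf_Ker f)
  refine ⟨fun X => ⟨fun A => ⟨Φ.app A, ?_⟩, fun S => τ.app S.1, fun A => h1 A,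
    fun S => Subtype.ext (h2 S.1 S.2)⟩, fun {X Y} f A B => ⟨fun h => Φ.mono h, fun h => ?_⟩⟩
  · obtain ⟨W, f, hf⟩ := hc X A
    exact ⟨W, f, (F.isKernelOf_iff _ _).1 (hΦ f _ hf)⟩
  · rw [← h1 A, ← h1 B]
    exact τ.mono h

theorem embedding_iff (F : OreanForm C) (G : Form C)
    (τ : Operator F.toForm G) (hτ : τ.Conormal) (Φ : Operator G F.toForm) (hΦ : Φ.Conormal)
    {I X Y : C} (m : I ⟶ Y) (f : X ⟶ Y) :
    F.IsEmbedding m (F.Im f) ↔ ∃ S, G.IsImageOf S f ∧ G.IsEmbeddingOf m S := by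
  have im : ∀ {W Z : C} (g : W ⟶ Z), G.IsImageOf (τ.app (F.Im g)) g :=
    fun g => hτ g _ (F.isImageOf_Im g)
  have im' : ∀ {W Z : C} (g : W ⟶ Z) (S : G.Cl Z), G.IsImageOf S g → Φ.app S = F.Im g :=
    fun g S h => ((F.isImageOf_iff _ _).1 (hΦ g S h)).symm
  constructor
  · rintro ⟨h1, h2⟩
    refine ⟨τ.app (F.Im f), im f, ?_, fun {W'} f' S' hS' hle => h2 f' ?_⟩
    · rw [← h1]; exact im m
    · have := Φ.mono hle
      rwa [im' f' S' hS', im' f _ (im f)] at this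
  · rintro ⟨S, hS, h1, h2⟩
    refine ⟨?_, fun {W'} f' hle => h2 f' _ (im f') ?_⟩
    · rw [← im' m S h1, ← im' f S hS]
    · have := τ.mono hle
      rwa [G.image_unique (im f) hS] at this

theorem quotient_iff (F : OreanForm C) (G : Form C)
    (τ : Operator F.toForm G) (hτ : τ.Normal) (Φ : Operator G F.toForm) (hΦ : Φ.Normal)
    {I X Y : C} (m : X ⟶ I) (f : X ⟶ Y) :
    F.IsQuotient m (F.Ker f) ↔ ∃ S, G.IsKernelOf S f ∧ G.IsQuotientOf m S := by
  have im : ∀ {W Z : C} (g : W ⟶ Z), G.IsKernelOf (τ.app (F.Ker g)) g :=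
    fun g => hτ g _ (F.isKernelOf_Ker g)
  have im' : ∀ {W Z : C} (g : W ⟶ Z) (S : G.Cl W), G.IsKernelOf S g → Φ.app S = F.Ker g :=
    fun g S h => ((F.isKernelOf_iff _ _).1 (hΦ g S h)).symm
  constructor
  · rintro ⟨h1, h2⟩
    refine ⟨τ.app (F.Ker f), im f, ?_, fun {W'} f' S' hS' hle => h2 f' ?_⟩
    · rw [← h1]; exact im m
    · have := Φ.mono hle
      rwa [im' f' S' hS', im' f _ (im f)] at this
  · rintro ⟨S, hS, h1, h2⟩
    refine ⟨?_, fun {W'} f' hle => h2 f' _ (im f') ?_⟩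
    · rw [← im' m S h1, ← im' f S hS]
    · have := τ.mono hle
      rwa [G.kernel_unique (im f) hS] at this

theorem part_one (F : OreanForm C) (κs κe : Operator F.toForm F.toForm)
    (hd : IsDecomp F κs κe) (hse : IsSemiexact F κs κe) :
      Form.IsIsomorphic (F.toForm.fixedSubform κs) F.conormalHull ∧
      Form.IsIsomorphic (F.toForm.fixedSubform κe) F.normalHull ∧
      F.StronglyOrean ∧
      (F.N2 ↔ Form.IsOreanFactorization (F.toForm.fixedSubform κs)
          (F.toForm.fixedSubform κe)) := by
  obtain ⟨⟨τs, hτs, hτsc, hτsn⟩, ⟨τe, hτe, hτec, hτen⟩, hso, hsc, heo, hen, ⟨α, hα⟩, ⟨β, hβ⟩⟩ := hse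
  obtain ⟨t, tmono, ht⟩ := decomp_term F κs κe hd.2
  let Φ : Operator (F.toForm.fixedSubform κs) F.toForm :=
    { app := fun {X} A => t X A.1 (α.app A).1
      mono := fun h => tmono h (α.mono h) }
  let Ψ : Operator (F.toForm.fixedSubform κe) F.toForm :=
    { app := fun {X} A => t X (β.app A).1 A.1
      mono := fun h => tmono (β.mono h) h }
  have hΦ : Φ.Conormal := by
    intro W X f S hS
    rw [F.isImageOf_iff]
    have e1 : S = τs.app (F.Im f) :=
      Form.image_unique _ hS (hτsc f _ (F.isImageOf_Im f))
    have e2 : α.app S = τe.app (F.Im f) :=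
      Form.image_unique _ (hα f _ hS) (hτec f _ (F.isImageOf_Im f))
    change _ = t X S.1 (α.app S).1
    rw [e2, e1, hτs, hτe, ht]
  have hΨ : Ψ.Normal := by
    intro W X f S hS
    rw [F.isKernelOf_iff]
    have e1 : S = τe.app (F.Ker f) :=
      Form.kernel_unique _ hS (hτen f _ (F.isKernelOf_Ker f))
    have e2 : β.app S = τs.app (F.Ker f) :=
      Form.kernel_unique _ (hβ f _ hS) (hτsn f _ (F.isKernelOf_Ker f))
    change _ = t W (β.app S).1 S.1
    rw [e2, e1, hτs, hτe, ht]
  have i1 := conormal_iso F _ τs hτsc Φ hΦ hsc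
  have i2 := normal_iso F _ τe hτen Ψ hΨ hen
  refine ⟨i1, i2, ⟨Form.isOrean_of_iso i1 hso, Form.isOrean_of_iso i2 heo⟩, ?_, ?_⟩
  · intro h
    refine ⟨hso, hsc, heo, hen, fun {X Y} f => ?_⟩
    obtain ⟨I, e, m, he, hm, hf⟩ := h f
    obtain ⟨K, hK1, hK2⟩ := (quotient_iff F _ τe hτen Ψ hΨ e f).1 he
    obtain ⟨S, hS1, hS2⟩ := (embedding_iff F _ τs hτsc Φ hΦ m f).1 hm
    exact ⟨I, e, m, K, S, hK1, hK2, hS1, hS2, hf⟩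
  · rintro ⟨-, -, -, -, h⟩ X Y f
    obtain ⟨I, e, m, K, S, hK1, hK2, hS1, hS2, hf⟩ := h f
    exact ⟨I, e, m, (quotient_iff F _ τe hτen Ψ hΨ e f).2 ⟨K, hK1, hK2⟩,
      (embedding_iff F _ τs hτsc Φ hΦ m f).2 ⟨S, hS1, hS2⟩, hf⟩

/-! ### Part (ii) -/

theorem quotient_Im_top {Fs Fe : OreanForm C} (h : OreanFactorization Fs Fe) {X Y : C}
    (e : X ⟶ Y) (he : Fe.IsQuotient e (Fe.Ker e)) : Fs.Im e = Fs.top Y := by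
  obtain ⟨I, e1, m, h1, h2, h3⟩ := h.2.2 e
  obtain ⟨s, hs, -⟩ := he.2 e1 (h1.1 ▸ Fe.rel_id _)
  rw [← h2.1]
  apply Fs.Im_eq_top_of_section s
  obtain ⟨k, -, hk⟩ := he.2 e (Fe.rel_id _)
  rw [hk (s ≫ m) (by simp only [← Category.assoc, hs, h3]), hk (𝟙 Y) (Category.comp_id _)]

theorem embedding_Ker_bot {Fs Fe : OreanForm C} (h : OreanFactorization Fs Fe) {X Y : C}
    (m : X ⟶ Y) (hm : Fs.IsEmbedding m (Fs.Im m)) : Fe.Ker m = Fe.bot X := by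
  obtain ⟨I, e, m1, h1, h2, h3⟩ := h.2.2 m
  obtain ⟨s, hs, -⟩ := hm.2 m1 (h2.1 ▸ Fs.rel_id _)
  rw [← h1.1]
  apply Fe.Ker_eq_bot_of_retraction e s
  obtain ⟨k, -, hk⟩ := hm.2 m (Fs.rel_id _)
  rw [hk (e ≫ s) (by simp only [Category.assoc, hs, h3]), hk (𝟙 X) (Category.id_comp _)]

theorem embedding_Ker_bot' {Fs Fe : OreanForm C} (h : OreanFactorization Fs Fe) {X Y : C}
    (m : X ⟶ Y) (hm : Fs.IsEmbedding m (Fs.Im m)) : Fs.Ker m = Fs.bot X := by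
  have mono : ∀ {W : C} (a b : W ⟶ X), a ≫ m = b ≫ m → a = b := by
    intro W a b hab
    exact (hm.2 (b ≫ m) (Fs.Im_comp_le b m)).unique hab rfl
  apply Fs.rel_antisymm _ (Fs.bot_le _)
  obtain ⟨W, k, hk⟩ := h.1 (Fs.Ker m)
  obtain ⟨Z, z, hz⟩ := h.1 (Fs.bot X)
  have hzm : Fs.Im (z ≫ m) = Fs.bot Y := by rw [Fs.Im_comp, hz, Fs.dimg_bot]
  obtain ⟨I, e', m', h1, h2, h3⟩ := h.2.2 (z ≫ m)
  have hm' : Fs.Im m' = Fs.bot Y := h2.1.trans hzm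
  obtain ⟨n, hn, -⟩ := hm.2 m' (by rw [hm']; exact Fs.bot_le _)
  have hen : e' ≫ n = z := mono _ _ (by rw [Category.assoc, hn, h3])
  have hkm : Fs.le (Fs.Im (k ≫ m)) (Fs.Im (z ≫ m)) := by
    rw [Fs.Im_comp, hk, hzm]
    exact Fs.dimg_le (Fs.iimg_rel m _)
  obtain ⟨l, hl, -⟩ := h2.2 (k ≫ m) hkm
  have hln : l ≫ n = k := mono _ _ (by rw [Category.assoc, hn, hl])
  have hq : Fs.Im e' = Fs.top I := quotient_Im_top h e' (by rw [h1.1]; exact h1)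
  have hnb : Fs.Im n = Fs.bot X := by
    rw [← hz, ← hen, Fs.Im_comp, hq]; rfl
  rw [← hk, ← hln, ← hnb]
  exact Fs.Im_comp_le l n

theorem quotient_Im_top' {Fs Fe : OreanForm C} (h : OreanFactorization Fs Fe) {X Y : C}
    (m : X ⟶ Y) (hm : Fe.IsQuotient m (Fe.Ker m)) : Fe.Im m = Fe.top Y := by
  have epi : ∀ {W : C} (a b : Y ⟶ W), m ≫ a = m ≫ b → a = b := by
    intro W a b hab
    exact (hm.2 (m ≫ b) (Fe.le_Ker_comp m b)).unique hab rfl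
  apply Fe.rel_antisymm (Fe.le_top _)
  obtain ⟨W, k, hk⟩ := h.2.1 (Fe.Im m)
  obtain ⟨Z, z, hz⟩ := h.2.1 (Fe.top Y)
  have hzm : Fe.Ker (m ≫ z) = Fe.top X := by rw [Fe.Ker_comp, hz, Fe.iimg_top]
  obtain ⟨I, m', e', h2, h1, h3⟩ := h.2.2 (m ≫ z)
  have hm' : Fe.Ker m' = Fe.top X := h2.1.trans hzm
  obtain ⟨n, hn, -⟩ := hm.2 m' (by rw [hm']; exact Fe.le_top _)
  have hen : n ≫ e' = z := epi _ _ (by rw [← Category.assoc, hn, h3])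
  have hkm : Fe.le (Fe.Ker (m ≫ z)) (Fe.Ker (m ≫ k)) := by
    rw [Fe.Ker_comp m k, hk, hzm]
    exact Fe.le_iimg (Fe.rel_dimg m _)
  obtain ⟨l, hl, -⟩ := h2.2 (m ≫ k) hkm
  have hln : n ≫ l = k := epi _ _ (by rw [← Category.assoc, hn, hl])
  have hq : Fe.Ker e' = Fe.bot I := embedding_Ker_bot h e' (by rw [h1.1]; exact h1)
  have hnb : Fe.Ker n = Fe.top Y := by
    rw [← hz, ← hen, Fe.Ker_comp, hq]; rfl
  rw [← hk, ← hln, ← hnb]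
  exact Fe.le_Ker_comp n l

theorem Ker_mono {Fs Fe : OreanForm C} (h : OreanFactorization Fs Fe) {X Y Z : C}
    (f : X ⟶ Y) (g : X ⟶ Z) (hle : Fe.le (Fe.Ker f) (Fe.Ker g)) :
    Fs.le (Fs.Ker f) (Fs.Ker g) := by
  obtain ⟨I, e, m, h1, h2, h3⟩ := h.2.2 f
  obtain ⟨k, hk, -⟩ := h1.2 g hle
  have : Fs.Ker f = Fs.Ker e := by
    rw [← h3, Fs.Ker_comp, embedding_Ker_bot' h m (by rw [h2.1]; exact h2)]; rfl
  rw [this, ← hk]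
  exact Fs.le_Ker_comp e k

theorem Im_mono {Fs Fe : OreanForm C} (h : OreanFactorization Fs Fe) {X Y Z : C}
    (f : X ⟶ Y) (g : Z ⟶ Y) (hle : Fs.le (Fs.Im f) (Fs.Im g)) :
    Fe.le (Fe.Im f) (Fe.Im g) := by
  obtain ⟨I, e, m, h1, h2, h3⟩ := h.2.2 g
  obtain ⟨k, hk, -⟩ := h2.2 f hle
  have : Fe.Im g = Fe.Im m := by
    rw [← h3, Fe.Im_comp, quotient_Im_top' h e (by rw [h1.1]; exact h1)]; rfl
  rw [this, ← hk]
  exact Fe.Im_comp_le k m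

theorem exists_alpha {Fs Fe : OreanForm C} (h : OreanFactorization Fs Fe) :
    ∃ α : Operator Fs.toForm Fe.toForm, ∀ {X Y : C} (f : X ⟶ Y), α.app (Fs.Im f) = Fe.Im f := by
  choose W g hg using fun (X : C) (S : Fs.Cl X) => h.1 S
  refine ⟨⟨fun {X} S => Fe.Im (g X S), fun {X Y f A B} hr => ?_⟩, fun {X Y} f => ?_⟩
  · apply Fe.rel_of_dimg_le
    rw [← Fe.Im_comp]
    apply Im_mono h
    rw [Fs.Im_comp, hg, hg]
    exact Fs.dimg_le hr
  · apply Fe.rel_antisymm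
    · exact Im_mono h _ _ (by rw [hg]; exact Fs.rel_id _)
    · exact Im_mono h _ _ (by rw [hg]; exact Fs.rel_id _)

theorem exists_beta {Fs Fe : OreanForm C} (h : OreanFactorization Fs Fe) :
    ∃ β : Operator Fe.toForm Fs.toForm, ∀ {X Y : C} (f : X ⟶ Y), β.app (Fe.Ker f) = Fs.Ker f := by
  choose W g hg using fun (X : C) (S : Fe.Cl X) => h.2.1 S
  refine ⟨⟨fun {X} S => Fs.Ker (g X S), fun {X Y f A B} hr => ?_⟩, fun {X Y} f => ?_⟩
  · apply Fs.rel_of_le_iimg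
    rw [← Fs.Ker_comp]
    apply Ker_mono h
    rw [Fe.Ker_comp, hg, hg]
    exact Fe.le_iimg hr
  · apply Fs.rel_antisymm
    · exact Ker_mono h _ _ (by rw [hg]; exact Fe.rel_id _)
    · exact Ker_mono h _ _ (by rw [hg]; exact Fe.rel_id _)

theorem OreanForm.rel_bot_bot (F : OreanForm C) {X Y : C} (f : X ⟶ Y) :
    F.Rel f (F.bot X) (F.bot Y) := F.rel_of_le_iimg (F.bot_le _)

theorem part_two (Fs Fe : OreanForm C) (h : OreanFactorization Fs Fe) :
      (Fs.prod Fe).N2 ∧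
      ∃ κs κe : Operator (Fs.prod Fe).toForm (Fs.prod Fe).toForm,
        IsJoinDecomp (Fs.prod Fe) κs κe ∧ IsSemiexact (Fs.prod Fe) κs κe ∧
        Form.IsIsomorphic ((Fs.prod Fe).toForm.fixedSubform κs) Fs.toForm ∧
        Form.IsIsomorphic ((Fs.prod Fe).toForm.fixedSubform κe) Fe.toForm := by
  constructor
  · intro X Y f
    obtain ⟨I, e, m, h1, h2, h3⟩ := h.2.2 f
    refine ⟨I, e, m, ⟨?_, fun {Y'} g' hle => h1.2 g' hle.2⟩,
      ⟨?_, fun {W'} f' hle => h2.2 f' hle.1⟩, h3⟩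
    · refine Prod.ext (Fs.rel_antisymm ?_ ?_) h1.1
      · exact Ker_mono h e f (by rw [h1.1]; exact Fe.rel_id _)
      · exact Ker_mono h f e (by rw [h1.1]; exact Fe.rel_id _)
    · refine Prod.ext h2.1 (Fe.rel_antisymm ?_ ?_)
      · exact Im_mono h m f (by rw [h2.1]; exact Fs.rel_id _)
      · exact Im_mono h f m (by rw [h2.1]; exact Fs.rel_id _)
  let κs : Operator (Fs.prod Fe).toForm (Fs.prod Fe).toForm :=
    { app := fun {X} A => (A.1, Fe.bot X)
      mono := fun {X Y f A B} hr => ⟨hr.1, Fe.rel_bot_bot f⟩ }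
  let κe : Operator (Fs.prod Fe).toForm (Fs.prod Fe).toForm :=
    { app := fun {X} A => (Fs.bot X, A.2)
      mono := fun {X Y f A B} hr => ⟨Fs.rel_bot_bot f, hr.2⟩ }
  let es : ∀ X : C, ((Fs.prod Fe).toForm.fixedSubform κs).Cl X ≃ Fs.Cl X := fun X =>
    { toFun := fun A => A.1.1
      invFun := fun S => ⟨(S, Fe.bot X), rfl⟩
      left_inv := fun A => Subtype.ext A.2
      right_inv := fun S => rfl }
  let ee : ∀ X : C, ((Fs.prod Fe).toForm.fixedSubform κe).Cl X ≃ Fe.Cl X := fun X =>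
    { toFun := fun A => A.1.2
      invFun := fun S => ⟨(Fs.bot X, S), rfl⟩
      left_inv := fun A => Subtype.ext A.2
      right_inv := fun S => rfl }
  have hes : ∀ {X Y : C} (f : X ⟶ Y) (A : ((Fs.prod Fe).toForm.fixedSubform κs).Cl X)
      (B : ((Fs.prod Fe).toForm.fixedSubform κs).Cl Y),
      ((Fs.prod Fe).toForm.fixedSubform κs).Rel f A B ↔ Fs.Rel f (es X A) (es Y B) := by
    intro X Y f A B
    refine ⟨fun hr => hr.1, fun hr => ⟨hr, ?_⟩⟩
    have hA : Fe.bot X = A.1.2 := congrArg Prod.snd A.2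
    have hB : Fe.bot Y = B.1.2 := congrArg Prod.snd B.2
    rw [← hA, ← hB]
    exact Fe.rel_bot_bot f
  have hee : ∀ {X Y : C} (f : X ⟶ Y) (A : ((Fs.prod Fe).toForm.fixedSubform κe).Cl X)
      (B : ((Fs.prod Fe).toForm.fixedSubform κe).Cl Y),
      ((Fs.prod Fe).toForm.fixedSubform κe).Rel f A B ↔ Fe.Rel f (ee X A) (ee Y B) := by
    intro X Y f A B
    refine ⟨fun hr => hr.2, fun hr => ⟨?_, hr⟩⟩
    have hA : Fs.bot X = A.1.1 := congrArg Prod.fst A.2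
    have hB : Fs.bot Y = B.1.1 := congrArg Prod.fst B.2
    rw [← hA, ← hB]
    exact Fs.rel_bot_bot f
  have is : Form.IsIsomorphic ((Fs.prod Fe).toForm.fixedSubform κs) Fs.toForm := ⟨es, hes⟩
  have ie : Form.IsIsomorphic ((Fs.prod Fe).toForm.fixedSubform κe) Fe.toForm := ⟨ee, hee⟩
  have oS := Form.isOrean_of_iso is.symm Fs.isOrean
  have oE := Form.isOrean_of_iso ie.symm Fe.isOrean
  have ims : ∀ {X Y : C} (f : X ⟶ Y) (S), ((Fs.prod Fe).toForm.fixedSubform κs).IsImageOf S f ↔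
      Fs.Im f = S.1.1 := fun f S =>
    (Form.isImageOf_iso es hes f S).trans (Fs.isImageOf_iff _ _)
  have ime : ∀ {X Y : C} (f : X ⟶ Y) (S), ((Fs.prod Fe).toForm.fixedSubform κe).IsImageOf S f ↔
      Fe.Im f = S.1.2 := fun f S =>
    (Form.isImageOf_iso ee hee f S).trans (Fe.isImageOf_iff _ _)
  have kes : ∀ {X Y : C} (f : X ⟶ Y) (S), ((Fs.prod Fe).toForm.fixedSubform κs).IsKernelOf S f ↔
      Fs.Ker f = S.1.1 := fun f S =>
    (Form.isKernelOf_iso es hes f S).trans (Fs.isKernelOf_iff _ _)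
  have kee : ∀ {X Y : C} (f : X ⟶ Y) (S), ((Fs.prod Fe).toForm.fixedSubform κe).IsKernelOf S f ↔
      Fe.Ker f = S.1.2 := fun f S =>
    (Form.isKernelOf_iso ee hee f S).trans (Fe.isKernelOf_iff _ _)
  have cS : ((Fs.prod Fe).toForm.fixedSubform κs).IsConormal := by
    intro X S
    obtain ⟨W, f, hf⟩ := h.1 S.1.1
    exact ⟨W, f, (ims f S).2 hf⟩
  have nE : ((Fs.prod Fe).toForm.fixedSubform κe).IsNormal := by
    intro X S
    obtain ⟨W, f, hf⟩ := h.2.1 S.1.2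
    exact ⟨W, f, (kee f S).2 hf⟩
  obtain ⟨α, hα⟩ := exists_alpha h
  obtain ⟨β, hβ⟩ := exists_beta h
  refine ⟨κs, κe, ⟨⟨fun _ => rfl, fun _ => rfl, oS, cS, oE, nE⟩, fun {X} S => ?_⟩,
    ⟨⟨⟨fun A => ⟨κs.app A, rfl⟩, fun hr => κs.mono hr⟩, fun _ => rfl, ?_, ?_⟩,
     ⟨⟨fun A => ⟨κe.app A, rfl⟩, fun hr => κe.mono hr⟩, fun _ => rfl, ?_, ?_⟩,
     oS, cS, oE, nE,
     ⟨⟨fun {X} A => (ee X).symm (α.app (es X A)), ?_⟩, ?_⟩,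
     ⟨⟨fun {X} A => (es X).symm (β.app (ee X A)), ?_⟩, ?_⟩⟩, is, ie⟩
  · exact Prod.ext (Fs.join_bot S.1).symm (Fe.bot_join S.2).symm
  · intro W X f S hS
    have := ((Fs.prod Fe).isImageOf_iff f S).1 hS
    exact (ims f _).2 (congrArg Prod.fst this)
  · intro W X f S hS
    have := ((Fs.prod Fe).isKernelOf_iff f S).1 hS
    exact (kes f _).2 (congrArg Prod.fst this)
  · intro W X f S hS
    have := ((Fs.prod Fe).isImageOf_iff f S).1 hS
    exact (ime f _).2 (congrArg Prod.snd this)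
  · intro W X f S hS
    have := ((Fs.prod Fe).isKernelOf_iff f S).1 hS
    exact (kee f _).2 (congrArg Prod.snd this)
  · intro X Y f A B hr
    exact (hee f _ _).2 (α.mono ((hes f _ _).1 hr))
  · intro W X f S hS
    have h1 := (ims f S).1 hS
    refine (ime f _).2 ?_
    rw [← hα f, h1]; rfl
  · intro X Y f A B hr
    exact (hes f _ _).2 (β.mono ((hee f _ _).1 hr))
  · intro W X f S hS
    have h1 := (kee f S).1 hS
    refine (kes f _).2 ?_
    rw [← hβ f, h1]; rfl

end Helpers

/-- Theorem: (i) if an orean form `F` has a semiexact decomposition `(κs, κe)`, then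
`F_s` is isomorphic to `F_c` and `F_e` is isomorphic to `F_n` (in particular `F` is
strongly orean), and `F` satisfies (N2) iff `(F_s, F_e)` is an orean factorization;
(ii) for any orean factorization `(Fs, Fe)`, the product form `Fs × Fe` satisfies (N2)
and has a semiexact join decomposition whose subforms are isomorphic to `Fs`, `Fe`. -/
theorem semiexact_decomposition_and_products {C : Type u} [Category.{v} C] :
    (∀ (F : OreanForm C) (κs κe : Operator F.toForm F.toForm),
      IsDecomp F κs κe → IsSemiexact F κs κe →
      Form.IsIsomorphic (F.toForm.fixedSubform κs) F.conormalHull ∧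
      Form.IsIsomorphic (F.toForm.fixedSubform κe) F.normalHull ∧
      F.StronglyOrean ∧
      (F.N2 ↔ Form.IsOreanFactorization (F.toForm.fixedSubform κs)
          (F.toForm.fixedSubform κe))) ∧
    (∀ Fs Fe : OreanForm C, OreanFactorization Fs Fe →
      (Fs.prod Fe).N2 ∧
      ∃ κs κe : Operator (Fs.prod Fe).toForm (Fs.prod Fe).toForm,
        IsJoinDecomp (Fs.prod Fe) κs κe ∧ IsSemiexact (Fs.prod Fe) κs κe ∧
        Form.IsIsomorphic ((Fs.prod Fe).toForm.fixedSubform κs) Fs.toForm ∧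
        Form.IsIsomorphic ((Fs.prod Fe).toForm.fixedSubform κe) Fe.toForm) := by
  exact ⟨fun F κs κe hd hse => part_one F κs κe hd hse, fun Fs Fe h => part_two Fs Fe h⟩
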